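/- Let n ≥ 1, let U ⊆ EuclideanSpace ℝ n be open, let f : EuclideanSpace ℝ n → ℝ be differentiable on U, let p ∈ U be a non-critical point of f (gradient f p ≠ 0), let W ∈ EuclideanSpace ℝ n with ‖W‖ < 1, and let F be the Zermelo–Randers norm with wind W. If v ≠ 0 is a Finsler gradient of f at p with respect to F, then F(v) = ‖gradient f p‖ + fderiv ℝ f p W, where gradient f p denotes the Euclidean (Riemannian) gradient of f at p. -/

import Mathlib

open RealInnerProductSpace

/-- The Zermelo–Randers norm with wind `W`:
`F(y) = (√(⟪W,y⟫² + λ‖y‖²) − ⟪W,y⟫)/λ` with `λ = 1 − ‖W‖²`.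
(The formula also gives `F 0 = 0`.) -/
noncomputable def zermeloRanders {n : ℕ} (W : EuclideanSpace ℝ (Fin n))
    (y : EuclideanSpace ℝ (Fin n)) : ℝ :=
  (Real.sqrt (⟪W, y⟫ ^ 2 + (1 - ‖W‖ ^ 2) * ‖y‖ ^ 2) - ⟪W, y⟫) / (1 - ‖W‖ ^ 2)

/-- The radicand in the Zermelo–Randers norm is positive away from the origin. -/
theorem zermeloRanders_radicand_pos {n : ℕ} {W v : EuclideanSpace ℝ (Fin n)} (hW : ‖W‖ < 1)
    (hv : v ≠ 0) : 0 < ⟪W, v⟫ ^ 2 + (1 - ‖W‖ ^ 2) * ‖v‖ ^ 2 := by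
  have hl : 0 < 1 - ‖W‖ ^ 2 := by nlinarith [norm_nonneg W]
  have := norm_pos_iff.2 hv
  positivity

/-- The Zermelo–Randers norm is positive away from the origin. -/
theorem zermeloRanders_pos {n : ℕ} {W v : EuclideanSpace ℝ (Fin n)} (hW : ‖W‖ < 1)
    (hv : v ≠ 0) : 0 < zermeloRanders W v := by
  have hl : 0 < 1 - ‖W‖ ^ 2 := by nlinarith [norm_nonneg W]
  have := norm_pos_iff.2 hv
  refine div_pos (sub_pos.2 ?_) hl
  refine (le_abs_self _).trans_lt (Real.lt_sqrt_of_sq_lt ?_)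
  rw [sq_abs]
  exact lt_add_of_pos_right _ (by positivity)

/-- The square root in the Zermelo–Randers norm, expressed through the norm itself. -/
theorem sqrt_radicand_eq_zermeloRanders {n : ℕ} {W : EuclideanSpace ℝ (Fin n)} (hW : ‖W‖ < 1)
    (v : EuclideanSpace ℝ (Fin n)) :
    √(⟪W, v⟫ ^ 2 + (1 - ‖W‖ ^ 2) * ‖v‖ ^ 2)
      = (1 - ‖W‖ ^ 2) * zermeloRanders W v + ⟪W, v⟫ := by
  have hl : 0 < 1 - ‖W‖ ^ 2 := by nlinarith [norm_nonneg W]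
  rw [zermeloRanders]
  field_simp
  ring

/-- The wind-shifted vector `v - F(v) W` has Euclidean norm `F(v)`. -/
theorem norm_sub_zermeloRanders_smul {n : ℕ} {W v : EuclideanSpace ℝ (Fin n)} (hW : ‖W‖ < 1)
    (hv : v ≠ 0) : ‖v - zermeloRanders W v • W‖ = zermeloRanders W v := by
  have hl : 0 < 1 - ‖W‖ ^ 2 := by nlinarith [norm_nonneg W]
  have hF := zermeloRanders_pos hW hv
  have hR := Real.sq_sqrt (zermeloRanders_radicand_pos hW hv).le
  have hRF := sqrt_radicand_eq_zermeloRanders hW v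
  rw [hRF] at hR
  refine (sq_eq_sq₀ (norm_nonneg _) hF.le).1 ?_
  rw [norm_sub_sq_real, norm_smul, real_inner_smul_right, real_inner_comm, mul_pow,
    Real.norm_eq_abs, sq_abs]
  refine mul_left_cancel₀ hl.ne' ?_
  linear_combination -hR

/-- The directional derivative of the Zermelo–Randers norm away from the origin. -/
theorem hasDerivAt_zermeloRanders {n : ℕ} {W v : EuclideanSpace ℝ (Fin n)} (hW : ‖W‖ < 1)
    (hv : v ≠ 0) (u : EuclideanSpace ℝ (Fin n)) :
    HasDerivAt (fun s : ℝ => zermeloRanders W (v + s • u))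
      (⟪v - zermeloRanders W v • W, u⟫ / √(⟪W, v⟫ ^ 2 + (1 - ‖W‖ ^ 2) * ‖v‖ ^ 2)) 0 := by
  have hl : 0 < 1 - ‖W‖ ^ 2 := by nlinarith [norm_nonneg W]
  have hq := zermeloRanders_radicand_pos hW hv
  have hline : HasDerivAt (fun s : ℝ => v + s • u) u 0 := by
    simpa using ((hasDerivAt_id (0 : ℝ)).smul_const u).const_add v
  have hinner : HasDerivAt (fun s : ℝ => ⟪W, v + s • u⟫) ⟪W, u⟫ 0 := by
    simpa using (hasDerivAt_const (0 : ℝ) W).inner ℝ hline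
  have hnorm : HasDerivAt (fun s : ℝ => ‖v + s • u‖ ^ 2) (2 * ⟪v, u⟫) 0 := by
    simpa using hline.norm_sq
  have hsqrt := ((hinner.pow 2).add (hnorm.const_mul (1 - ‖W‖ ^ 2))).sqrt (by simpa using hq.ne')
  refine ((hsqrt.sub hinner).div_const (1 - ‖W‖ ^ 2)).congr_deriv ?_
  have hR := Real.sqrt_pos.2 hq
  simp only [Pi.add_apply, Pi.pow_apply, zero_smul, add_zero, inner_sub_left,
    real_inner_smul_left, zermeloRanders]
  field_simp
  ring

/-- Lemma relating Finsler and Riemannian gradients, item (ii).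
If `v ≠ 0` is a Finsler gradient of `f` at a non-critical point `p` with respect to the
Zermelo–Randers norm with wind `W`, then `F(v) = ‖∇̃f(p)‖ + df(W)`,
where `∇̃` is the Euclidean gradient. -/
theorem finsler_gradient_norm_relation
    (n : ℕ) (hn : 1 ≤ n)
    (U : Set (EuclideanSpace ℝ (Fin n))) (hU : IsOpen U)
    (f : EuclideanSpace ℝ (Fin n) → ℝ) (hf : DifferentiableOn ℝ f U)
    (p : EuclideanSpace ℝ (Fin n)) (hp : p ∈ U)
    (hcrit : gradient f p ≠ 0)
    (W : EuclideanSpace ℝ (Fin n)) (hW : ‖W‖ < 1)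
    (v : EuclideanSpace ℝ (Fin n)) (hv : v ≠ 0)
    (hFgrad : ∀ u, fderiv ℝ f p u =
      (1 / 2 : ℝ) * deriv (fun s : ℝ => (zermeloRanders W (v + s • u)) ^ 2) 0) :
    zermeloRanders W v = ‖gradient f p‖ + fderiv ℝ f p W := by
  have hF := zermeloRanders_pos hW hv
  have hR := Real.sqrt_pos.2 (zermeloRanders_radicand_pos hW hv)
  have hRF := sqrt_radicand_eq_zermeloRanders hW v
  have hN := norm_sub_zermeloRanders_smul hW hv
  have hD := hasDerivAt_zermeloRanders hW hv
  set R := √(⟪W, v⟫ ^ 2 + (1 - ‖W‖ ^ 2) * ‖v‖ ^ 2)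
  set F := zermeloRanders W v with hFdef
  have hdf (u) : fderiv ℝ f p u = ⟪(F / R) • (v - F • W), u⟫ := by
    have hderiv := ((hD u).pow 2).deriv
    simp only [Pi.pow_def, zero_smul, add_zero, ← hFdef] at hderiv
    rw [hFgrad, hderiv, real_inner_smul_left]
    push_cast
    ring
  have hgrad : gradient f p = (F / R) • (v - F • W) := by
    refine ext_inner_right ℝ fun u => ?_
    rw [← hdf, gradient, InnerProductSpace.toDual_symm_apply]
  rw [hgrad, hdf, norm_smul, hN, Real.norm_of_nonneg (by positivity), real_inner_smul_left,
    inner_sub_left, real_inner_smul_left, real_inner_self_eq_norm_sq, real_inner_comm]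
  field_simp
  linear_combination hRF
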